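/- Let (H_t)_{t=0}^T be an adapted, integrable real-valued process with Snell envelope (U_t)_{t=0}^T, and let τ_min = min{ t ∈ {0,1,…,T} : U_t = H_t }. Then the stopping time τ_min attains the value of the Snell envelope at time 0: E[H_{τ_min}] = E[U_0]. -/

import Mathlib

open MeasureTheory

/-- If `U t = P[U (t + 1)|ℱ t]` on the `ℱ t`-measurable event `{t < τ}`, then `U` stopped at
`min (t + 1) τ` is integrable with the same expectation as `U` stopped at `min t τ`. -/
lemma integral_stopped_succ_eq
    {Ω : Type*} {m : MeasurableSpace Ω} {P : Measure Ω} [IsFiniteMeasure P]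
    (ℱ : Filtration ℕ m) (U : ℕ → Ω → ℝ) (τ : Ω → ℕ) (t : ℕ)
    (hUt : Integrable (U t) P) (hUt' : Integrable (U (t + 1)) P)
    (hA : MeasurableSet[ℱ t] {ω | t < τ ω})
    (hcond : ∀ ω, t < τ ω → U t ω = (P[U (t + 1)|ℱ t]) ω)
    (hint : Integrable (fun ω => U (min t (τ ω)) ω) P) :
    Integrable (fun ω => U (min (t + 1) (τ ω)) ω) P ∧
      ∫ ω, U (min (t + 1) (τ ω)) ω ∂P = ∫ ω, U (min t (τ ω)) ω ∂P := by
  have hAm : MeasurableSet {ω | t < τ ω} := ℱ.le t _ hA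
  have hstep : (fun ω => U (min (t + 1) (τ ω)) ω) = fun ω => U (min t (τ ω)) ω +
      Set.indicator {ω | t < τ ω} (fun ω => U (t + 1) ω - U t ω) ω := by
    funext ω
    by_cases h : t < τ ω
    · rw [Set.indicator_of_mem (show ω ∈ {ω | t < τ ω} from h), min_eq_left h.le,
        min_eq_left (Nat.succ_le_of_lt h)]
      ring
    · rw [Set.indicator_of_notMem (show ω ∉ {ω | t < τ ω} from h), min_eq_right (not_lt.mp h),
        min_eq_right ((not_lt.mp h).trans t.le_succ), add_zero]
  have hincr : Integrable
      (Set.indicator {ω | t < τ ω} (fun ω => U (t + 1) ω - U t ω)) P :=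
    (hUt'.sub hUt).indicator hAm
  have hzero : ∫ ω in {ω | t < τ ω}, (U (t + 1) ω - U t ω) ∂P = 0 := by
    rw [integral_sub hUt'.integrableOn hUt.integrableOn, setIntegral_congr_fun hAm hcond,
      setIntegral_condExp (ℱ.le t) hUt' hA, sub_self]
  rw [hstep]
  exact ⟨hint.add hincr, by rw [integral_add hint hincr, integral_indicator hAm, hzero, add_zero]⟩

/-- The Snell envelope of an adapted integrable process is adapted and integrable. -/
lemma snell_measurable_integrable
    {Ω : Type*} {m : MeasurableSpace Ω} {P : Measure Ω}
    (T : ℕ) (ℱ : Filtration ℕ m) (H U : ℕ → Ω → ℝ)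
    (hH_adapted : Adapted ℱ H)
    (hH_int : ∀ t, Integrable (H t) P)
    (hUT : U T = H T)
    (hU : ∀ t < T, U t = fun ω => max (H t ω) ((P[U (t + 1)|ℱ t]) ω))
    (t : ℕ) (ht : t ≤ T) : Measurable[ℱ t] (U t) ∧ Integrable (U t) P := by
  rcases ht.eq_or_lt with rfl | ht
  · exact hUT ▸ ⟨hH_adapted t, hH_int t⟩
  · rw [hU t ht]
    exact ⟨(hH_adapted t).max stronglyMeasurable_condExp.measurable,
      (hH_int t).sup integrable_condExp⟩


/-- **`τ_min` attains the value of the Snell envelope at time 0.**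
Let `(H t)_{t ≤ T}` be an adapted, integrable real-valued process with Snell envelope `U`
(so `U T = H T` and `U t = max (H t) (E[U (t+1) | ℱ t])` for `t < T`), and let
`τ_min ω = min {t ∈ {0,…,T} : U t ω = H t ω}`. Then `E[H_{τ_min}] = E[U 0]`. -/
theorem tauMin_attains
    {Ω : Type*} {m : MeasurableSpace Ω} {P : Measure Ω} [IsProbabilityMeasure P]
    (T : ℕ) (ℱ : Filtration ℕ m) (H U : ℕ → Ω → ℝ)
    (hH_adapted : Adapted ℱ H)
    (hH_int : ∀ t, Integrable (H t) P)
    (hUT : U T = H T)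
    (hU : ∀ t < T, U t = fun ω => max (H t ω) ((P[U (t + 1)|ℱ t]) ω))
    (τ : Ω → ℕ)
    (hτ : ∀ ω, τ ω = sInf {t | t ≤ T ∧ U t ω = H t ω}) :
    ∫ ω, H (τ ω) ω ∂P = ∫ ω, U 0 ω ∂P := by
  have hTmem : ∀ ω, T ∈ {t | t ≤ T ∧ U t ω = H t ω} := fun ω => ⟨le_rfl, congrFun hUT ω⟩
  have hτT : ∀ ω, τ ω ≤ T := fun ω => hτ ω ▸ Nat.sInf_le (hTmem ω)
  have hτU : ∀ ω, U (τ ω) ω = H (τ ω) ω := fun ω => by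
    have h := Nat.sInf_mem ⟨T, hTmem ω⟩
    rw [← hτ ω] at h
    exact h.2
  have hne : ∀ ω, ∀ s < τ ω, U s ω ≠ H s ω := fun ω s hs heq =>
    Nat.notMem_of_lt_sInf (s := {t | t ≤ T ∧ U t ω = H t ω}) (hs.trans_eq (hτ ω))
      ⟨hs.le.trans (hτT ω), heq⟩
  have hreg := snell_measurable_integrable T ℱ H U hH_adapted hH_int hUT hU
  have hA : ∀ t < T, MeasurableSet[ℱ t] {ω | t < τ ω} := fun t ht => by
    have heq : {ω | t < τ ω} = ⋂ s ∈ Set.Iic t, {ω | U s ω = H s ω}ᶜ := by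
      ext ω
      simp only [Set.mem_ofPred_eq, Set.mem_iInter, Set.mem_Iic, Set.mem_compl_iff]
      exact ⟨fun h s hs => hne ω s (hs.trans_lt h),
        fun h => not_le.mp fun hle => h _ hle (hτU ω)⟩
    rw [heq]
    refine MeasurableSet.biInter (Set.to_countable _) fun s hs => ?_
    exact ℱ.mono hs _
      (measurableSet_eq_fun (hreg s (hs.out.trans ht.le)).1 (hH_adapted s)).compl
  have hstopped : ∀ t ≤ T, Integrable (fun ω => U (min t (τ ω)) ω) P ∧
      ∫ ω, U (min t (τ ω)) ω ∂P = ∫ ω, U 0 ω ∂P := by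
    intro t
    induction t with
    | zero => simpa using fun h => (hreg 0 h).2
    | succ t ih =>
      intro ht
      have hcond : ∀ ω, t < τ ω → U t ω = (P[U (t + 1)|ℱ t]) ω := fun ω hω => by
        have hmax := congrFun (hU t ht) ω
        rcases max_choice (H t ω) ((P[U (t + 1)|ℱ t]) ω) with h | h
        · exact absurd (hmax.trans h) (hne ω t hω)
        · exact hmax.trans h
      obtain ⟨hint, heq⟩ := ih (Nat.le_of_succ_le ht)
      obtain ⟨hint', heq'⟩ := integral_stopped_succ_eq ℱ U τ t (hreg t (Nat.le_of_succ_le ht)).2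
        (hreg (t + 1) ht).2 (hA t ht) hcond hint
      exact ⟨hint', heq'.trans heq⟩
  rw [← (hstopped T le_rfl).2]
  simp only [min_eq_right (hτT _), hτU]
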